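/- Let I be a nonempty finite type and let M : Matrix I I ℤ be a symmetric negative definite matrix such that M i j ≥ 0 for all i ≠ j. If a vector D : I → ℤ satisfies (M *ᵥ D) i < 0 for every i ∈ I, then D i > 0 for every i ∈ I. (Every element of the strict Lipman semigroup is a strictly positive divisor.) -/

import Mathlib

open Matrix

/-- The quadratic form of an integer matrix that is negative definite over `ℝ` is negative at
nonzero integer vectors. -/
theorem dotProduct_mulVec_neg_of_posDef_neg_map {I : Type*} [Fintype I] {M : Matrix I I ℤ}
    (hM : ((-M).map (Int.cast : ℤ → ℝ)).PosDef) {x : I → ℤ} (hx : x ≠ 0) :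
    x ⬝ᵥ (M *ᵥ x) < 0 := by
  have hx' : (fun i => (x i : ℝ)) ≠ 0 := fun h =>
    hx (funext fun i => by simpa using congrFun h i)
  have h := hM.dotProduct_mulVec_pos hx'
  simp only [dotProduct, mulVec, map_apply, Matrix.neg_apply, Pi.star_apply, star_trivial] at h
  have h' : 0 < ∑ i, x i * ∑ j, -M i j * x j := by exact_mod_cast h
  simpa [dotProduct, mulVec, Finset.sum_neg_distrib] using h'

/-- A vector on which a negative definite integer matrix with nonnegative off-diagonal entries
takes nonpositive values is nonnegative. -/
theorem nonneg_of_mulVec_nonpos {I : Type*} [Fintype I] {M : Matrix I I ℤ}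
    (hM : ((-M).map (Int.cast : ℤ → ℝ)).PosDef) (hoff : ∀ i j : I, i ≠ j → 0 ≤ M i j)
    {D : I → ℤ} (hD : ∀ i, (M *ᵥ D) i ≤ 0) (i : I) : 0 ≤ D i := by
  by_contra! hi
  let N : I → ℤ := fun i => max (-D i) 0
  have hN : ∀ i, 0 ≤ N i := fun i => le_max_right _ _
  have hne : N ≠ 0 := fun h => by
    have : max (-D i) 0 = 0 := congrFun h i
    omega
  have hneg := dotProduct_mulVec_neg_of_posDef_neg_map hM hne
  have hnonpos : N ⬝ᵥ (M *ᵥ D) ≤ 0 :=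
    Finset.sum_nonpos fun i _ => mul_nonpos_of_nonneg_of_nonpos (hN i) (hD i)
  have hterm : ∀ i j, 0 ≤ N i * (M i j * (D j + N j)) := by
    intro i j
    have hj : 0 ≤ D j + N j := by
      have : -D j ≤ N j := le_max_left _ _
      linarith
    rcases eq_or_ne i j with rfl | hij
    · rcases max_choice (-D i) 0 with h | h <;> simp [N, h]
    · exact mul_nonneg (hN i) (mul_nonneg (hoff i j hij) hj)
  have hsum : 0 ≤ N ⬝ᵥ (M *ᵥ (D + N)) :=
    Finset.sum_nonneg fun i _ => by
      simpa [mulVec, dotProduct, Finset.mul_sum] using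
        Finset.sum_nonneg fun j _ => hterm i j
  rw [mulVec_add, dotProduct_add] at hsum
  linarith

/-- Every element of the strict Lipman semigroup of a (negative definite,
symmetric, with nonnegative off-diagonal entries) intersection matrix is
strictly positive: if `(M *ᵥ D) i < 0` for all `i`, then `D i > 0` for all `i`. -/
theorem strict_lipman_cone_positive {I : Type*} [Fintype I] [Nonempty I]
    (M : Matrix I I ℤ) (hsymm : M.IsSymm)
    (hnegdef : ((-M).map (Int.cast : ℤ → ℝ)).PosDef)
    (hoff : ∀ i j : I, i ≠ j → 0 ≤ M i j)
    (D : I → ℤ) (hD : ∀ i : I, (M *ᵥ D) i < 0) :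
    ∀ i : I, 0 < D i := by
  intro i
  have hnonneg := nonneg_of_mulVec_nonpos hnegdef hoff fun i => (hD i).le
  refine (hnonneg i).lt_of_ne fun hi => (hD i).not_ge ?_
  refine Finset.sum_nonneg fun j _ => ?_
  rcases eq_or_ne i j with rfl | hij
  · simp [← hi]
  · exact mul_nonneg (hoff i j hij) (hnonneg j)
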